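/- Let 0 < k < 1 and 0 < a < 1, and consider Ω_k,a = ℂ \ ([k,1] ∪ [1/a, ∞)). As a → 0 with k fixed, the harmonic measure of [1/a, ∞) in Ω_{k,a} evaluated at 0 tends to 0; consequently ω_{Ω_{k,a}}([k,1], 0) → 1 as a → 0. -/

import Mathlib

open MeasureTheory Filter Complex

/-- `u` is harmonic on an open set `Ω ⊆ ℂ` (mean value property). -/
def IsHarmonicOnSet (u : ℂ → ℝ) (Ω : Set ℂ) : Prop :=
  ContinuousOn u Ω ∧
  ∀ z ∈ Ω, ∀ r : ℝ, 0 < r → Metric.closedBall z r ⊆ Ω →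
    u z = (2 * Real.pi)⁻¹ *
      ∫ θ in (0:ℝ)..(2 * Real.pi), u (z + r * Complex.exp (θ * Complex.I))

/-- The domain `Ω_{k,a} = ℂ \ ([k,1] ∪ [1/a, ∞))`. -/
def slitDomain (k a : ℝ) : Set ℂ :=
  ((fun x : ℝ => (x : ℂ)) '' (Set.Icc k 1 ∪ Set.Ici a⁻¹))ᶜ

open Metric in
/-- Circle average of `‖w‖²`. -/
lemma circleAverage_normSq_aux (z : ℂ) (r : ℝ) :
    Real.circleAverage (fun w : ℂ => ‖w‖ ^ 2) z r = ‖z‖ ^ 2 + r ^ 2 := by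
  have h : ∀ θ : ℝ, ‖circleMap z r θ‖ ^ 2
      = (‖z‖ ^ 2 + r ^ 2) + 2 * r * z.re * Real.cos θ + 2 * r * z.im * Real.sin θ := by
    intro θ
    rw [← Complex.normSq_eq_norm_sq, ← Complex.normSq_eq_norm_sq, Complex.normSq_apply,
      Complex.normSq_apply]
    have h1 : (circleMap z r θ).re = z.re + r * Real.cos θ := by
      simp [circleMap, Complex.exp_re]
    have h2 : (circleMap z r θ).im = z.im + r * Real.sin θ := by
      simp [circleMap, Complex.exp_im]
    rw [h1, h2]
    linear_combination r ^ 2 * Real.sin_sq_add_cos_sq θ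
  simp only [Real.circleAverage_def, h]
  rw [intervalIntegral.integral_add, intervalIntegral.integral_add,
    intervalIntegral.integral_const_mul, intervalIntegral.integral_const_mul]
  · simp
    field_simp
  all_goals exact Continuous.intervalIntegrable (by fun_prop) _ _

open Metric in
/-- Maximum principle for functions with a local sub-mean value property. -/
lemma max_principle_aux (K : Set ℂ) (ρ : ℝ) (h : ℂ → ℝ)
    (hc : ContinuousOn h (closedBall 0 ρ \ K))
    (hsub : ∀ z ∈ ball (0 : ℂ) ρ \ K, ∃ r > 0, closedBall z r ⊆ ball 0 ρ \ K ∧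
      h z ≤ Real.circleAverage h z r)
    (hbd : ∀ z ∈ sphere (0 : ℂ) ρ, z ∉ K → h z ≤ 0)
    (hslit : ∀ x ∈ K, ∀ δ > 0, ∀ᶠ z in nhdsWithin x Kᶜ, h z < δ) :
    ∀ z ∈ ball (0 : ℂ) ρ \ K, h z ≤ 0 := by
  intro z1 hz1
  by_contra! hpos
  obtain ⟨ε, hε, hεlt⟩ : ∃ ε > 0, 0 < h z1 + ε * (‖z1‖ ^ 2 - ρ ^ 2) := by
    refine ⟨h z1 / (2 * (ρ ^ 2 + 1)), by positivity, ?_⟩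
    have h1 : h z1 / (2 * (ρ ^ 2 + 1)) * (ρ ^ 2 + 1) = h z1 / 2 := by field_simp
    have h2 : 0 < h z1 / (2 * (ρ ^ 2 + 1)) := by positivity
    nlinarith [mul_nonneg h2.le (sq_nonneg ‖z1‖)]
  set φ : ℂ → ℝ := fun z => h z + ε * (‖z‖ ^ 2 - ρ ^ 2) with hφ
  have hφc : ContinuousOn φ (closedBall 0 ρ \ K) := by
    apply hc.add
    fun_prop
  set δ := φ z1 with hδ
  have hδpos : 0 < δ := hεlt
  have hφle : ∀ z ∈ closedBall (0 : ℂ) ρ, φ z ≤ h z := by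
    intro z hz
    have : ‖z‖ ≤ ρ := by simpa using hz
    have : ‖z‖ ^ 2 ≤ ρ ^ 2 := by gcongr
    simp only [hφ]
    nlinarith
  set S : Set ℂ := {z | z ∈ closedBall (0 : ℂ) ρ \ K ∧ δ ≤ φ z} with hS
  have hSsub : S ⊆ closedBall 0 ρ := fun z hz => hz.1.1
  have hSclosed : IsClosed S := by
    rw [← closure_subset_iff_isClosed]
    intro x hx
    have hxb : x ∈ closedBall (0 : ℂ) ρ := closure_minimal hSsub isClosed_closedBall hx
    have hne : (nhdsWithin x S).NeBot := mem_closure_iff_nhdsWithin_neBot.1 hx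
    have hmem : ∀ᶠ z in nhdsWithin x S, z ∈ S := self_mem_nhdsWithin
    by_cases hxK : x ∈ K
    · exfalso
      have h1 := hslit x hxK δ hδpos
      have h2 : ∀ᶠ z in nhdsWithin x S, h z < δ :=
        h1.filter_mono (nhdsWithin_mono _ fun z hz => hz.1.2)
      obtain ⟨z, hz1, hz2⟩ := (h2.and hmem).exists
      have := hφle z hz2.1.1
      have := hz2.2
      linarith
    · refine ⟨⟨hxb, hxK⟩, ?_⟩
      have h1 : Tendsto φ (nhdsWithin x S) (nhds (φ x)) :=
        (hφc x ⟨hxb, hxK⟩).mono (fun z hz => hz.1)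
      exact ge_of_tendsto h1 (hmem.mono fun z hz => hz.2)
  have hScpt : IsCompact S := (isCompact_closedBall (0 : ℂ) ρ).of_isClosed_subset hSclosed hSsub
  obtain ⟨z0, hz0, hmax⟩ := hScpt.exists_isMaxOn ⟨z1, ⟨ball_subset_closedBall hz1.1, hz1.2⟩, le_rfl⟩
    (hφc.mono fun z hz => hz.1)
  have hz0K := hz0.1.2
  have hz0pos : 0 < φ z0 := lt_of_lt_of_le hδpos hz0.2
  have hz0b : z0 ∈ ball (0 : ℂ) ρ := by
    rcases lt_or_eq_of_le (mem_closedBall.1 hz0.1.1) with h1 | h1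
    · exact h1
    · have := hbd z0 h1 hz0K
      have := hφle z0 hz0.1.1
      linarith
  obtain ⟨r, hr, hrsub, hmean⟩ := hsub z0 ⟨hz0b, hz0K⟩
  have hle : ∀ w ∈ closedBall z0 r, h w ≤ φ z0 - ε * (‖w‖ ^ 2 - ρ ^ 2) := by
    intro w hw
    have hw' := hrsub hw
    have : φ w ≤ φ z0 := by
      by_cases hwS : δ ≤ φ w
      · exact hmax ⟨⟨ball_subset_closedBall hw'.1, hw'.2⟩, hwS⟩
      · exact (not_le.1 hwS).le.trans hz0.2
    simp only [hφ] at this ⊢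
    linarith
  have hI1 : CircleIntegrable h z0 r := by
    apply ContinuousOn.circleIntegrable hr.le
    apply hc.mono
    intro w hw
    have := hrsub (sphere_subset_closedBall hw)
    exact ⟨ball_subset_closedBall this.1, this.2⟩
  have hI2 : CircleIntegrable (fun w : ℂ => ‖w‖ ^ 2) z0 r :=
    ContinuousOn.circleIntegrable hr.le (by fun_prop)
  have hI3 : CircleIntegrable (fun w : ℂ => φ z0 - ε * (‖w‖ ^ 2 - ρ ^ 2)) z0 r :=
    ContinuousOn.circleIntegrable hr.le (by fun_prop)
  have hav := Real.circleAverage_mono hI1 hI3 (by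
    intro w hw
    rw [abs_of_pos hr] at hw
    exact hle w (sphere_subset_closedBall hw))
  have hev : Real.circleAverage (fun w : ℂ => φ z0 - ε * (‖w‖ ^ 2 - ρ ^ 2)) z0 r
      = φ z0 - ε * ((‖z0‖ ^ 2 + r ^ 2) - ρ ^ 2) := by
    have : (fun w : ℂ => φ z0 - ε * (‖w‖ ^ 2 - ρ ^ 2))
        = fun w => (fun _ : ℂ => φ z0 + ε * ρ ^ 2) w - (fun w : ℂ => ε • (‖w‖ ^ 2)) w := by
      funext w
      simp only [smul_eq_mul]
      ring
    rw [this, Real.circleAverage_fun_sub (by simp) hI2.const_fun_smul,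
      Real.circleAverage_const, Real.circleAverage_fun_smul, circleAverage_normSq_aux, smul_eq_mul]
    ring
  rw [hev] at hav
  have : 0 < ε * r ^ 2 := by positivity
  simp only [hφ] at hav
  linarith

/-- Logarithmic potential of the segment `[k,1]`. -/
noncomputable def segPot (k : ℝ) (z : ℂ) : ℝ := ∫ t in k..1, Real.log ‖z - (t : ℂ)‖

/-- Truncated potential. -/
noncomputable def segPotT (k δ : ℝ) (z : ℂ) : ℝ :=
  ∫ t in k..1, Real.log (max ‖z - (t : ℂ)‖ δ)

lemma segPot_eq_trunc (k δ : ℝ) (hk : k ≤ 1) (z : ℂ)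
    (h : ∀ t ∈ Set.Icc k 1, δ ≤ ‖z - ((t : ℝ) : ℂ)‖) : segPot k z = segPotT k δ z := by
  unfold segPot segPotT
  apply intervalIntegral.integral_congr
  intro t ht
  rw [Set.uIcc_of_le hk] at ht
  simp only [max_eq_left (h t ht)]

lemma trunc_cont (δ : ℝ) (hδ : 0 < δ) :
    Continuous (fun p : ℂ × ℝ => Real.log (max ‖p.1 - (p.2 : ℂ)‖ δ)) := by
  apply Continuous.log
  · fun_prop
  · intro p
    exact (lt_of_lt_of_le hδ (le_max_right _ _)).ne'

lemma segPotT_cont (k δ : ℝ) (hδ : 0 < δ) : Continuous (segPotT k δ) := by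
  unfold segPotT
  apply intervalIntegral.continuous_parametric_intervalIntegral_of_continuous'
  exact trunc_cont δ hδ

lemma trunc_cond (k r : ℝ) (z : ℂ)
    (h : Metric.closedBall z (2 * r) ⊆ ((fun x : ℝ => (x : ℂ)) '' Set.Icc k 1)ᶜ)
    (w : ℂ) (hw : w ∈ Metric.closedBall z r) (t : ℝ) (ht : t ∈ Set.Icc k 1) :
    r ≤ ‖w - (t : ℂ)‖ := by
  by_contra! hlt
  refine h (a := (t : ℂ)) ?_ ⟨t, ht, rfl⟩
  rw [Metric.mem_closedBall] at hw ⊢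
  have := dist_triangle (t : ℂ) w z
  rw [dist_comm (t : ℂ) w, dist_eq_norm w] at this
  linarith

lemma segPot_contAt (k r : ℝ) (hk : k ≤ 1) (hr : 0 < r) (z : ℂ)
    (h : Metric.closedBall z (2 * r) ⊆ ((fun x : ℝ => (x : ℂ)) '' Set.Icc k 1)ᶜ) :
    ContinuousAt (segPot k) z := by
  refine (segPotT_cont k r hr).continuousAt.congr ?_
  filter_upwards [Metric.closedBall_mem_nhds z hr] with w hw
  exact (segPot_eq_trunc k r hk w fun t ht => trunc_cond k r z h w hw t ht).symm

lemma segPot_mean (k r : ℝ) (hk : k ≤ 1) (hr : 0 < r) (z : ℂ)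
    (h : Metric.closedBall z (2 * r) ⊆ ((fun x : ℝ => (x : ℂ)) '' Set.Icc k 1)ᶜ) :
    Real.circleAverage (segPot k) z r = segPot k z := by
  have h1 : Real.circleAverage (segPot k) z r = Real.circleAverage (segPotT k r) z r := by
    apply Real.circleAverage_congr_sphere
    intro w hw
    rw [abs_of_pos hr] at hw
    exact segPot_eq_trunc k r hk w fun t ht =>
      trunc_cond k r z h w (Metric.sphere_subset_closedBall hw) t ht
  rw [h1, Real.circleAverage_def]
  unfold segPotT
  rw [intervalIntegral_intervalIntegral_swap, ← intervalIntegral.integral_smul]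
  · unfold segPot
    apply intervalIntegral.integral_congr
    intro t ht
    rw [Set.uIcc_of_le hk] at ht
    have hz : r < ‖z - (t : ℂ)‖ := by
      by_contra! hlt
      refine h (a := (t : ℂ)) ?_ ⟨t, ht, rfl⟩
      rw [Metric.mem_closedBall, dist_comm, dist_eq_norm]
      linarith
    have h2 := circleAverage_log_norm_sub_const_eq_log_radius_add_posLog (a := (t : ℂ)) (c := z)
      (R := r) hr.ne'
    have h3 : Real.log r + Real.posLog (r⁻¹ * ‖z - (t : ℂ)‖) = Real.log ‖z - (t : ℂ)‖ := by
      rw [Real.posLog_eq_log, Real.log_mul (by positivity) (by linarith), Real.log_inv]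
      · ring
      · rw [abs_of_nonneg (by positivity), inv_mul_eq_div, le_div_iff₀ hr]
        linarith
    rw [h3] at h2
    simp only
    rw [← h2, Real.circleAverage_def]
    congr 1
    apply intervalIntegral.integral_congr
    intro θ _
    simp only
    rw [max_eq_left]
    exact trunc_cond k r z h _ (circleMap_mem_closedBall _ hr.le _) t ht
  · have hcont : Continuous (Function.uncurry fun (θ t : ℝ) =>
        Real.log (max ‖circleMap z r θ - (t : ℂ)‖ r)) :=
      (trunc_cont r hr).comp
        (f := fun p : ℝ × ℝ => (circleMap z r p.1, p.2)) (by fun_prop)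
    refine (hcont.continuousOn.integrableOn_compact
      (isCompact_uIcc.prod isCompact_uIcc)).mono_set
      (Set.prod_mono Set.uIoc_subset_uIcc Set.uIoc_subset_uIcc)

lemma dist_seg (k : ℝ) (z : ℂ) (hz : z ∉ (fun x : ℝ => (x : ℂ)) '' Set.Icc k 1) :
    ∃ r > 0, Metric.closedBall z (2 * r) ⊆ ((fun x : ℝ => (x : ℂ)) '' Set.Icc k 1)ᶜ := by
  have hcl : IsClosed ((fun x : ℝ => (x : ℂ)) '' Set.Icc k 1) :=
    (isCompact_Icc.image Complex.continuous_ofReal).isClosed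
  obtain ⟨r, hr, h⟩ := Metric.nhds_basis_closedBall.mem_iff.1 (hcl.isOpen_compl.mem_nhds hz)
  exact ⟨r / 2, by positivity, by rwa [mul_div_cancel₀ _ (by norm_num)]⟩

lemma seg_intble (k : ℝ) (hk : k ≤ 1) (z : ℂ)
    (hz : z ∉ (fun x : ℝ => (x : ℂ)) '' Set.Icc k 1) :
    IntervalIntegrable (fun t : ℝ => Real.log ‖z - (t : ℂ)‖) volume k 1 := by
  apply ContinuousOn.intervalIntegrable
  apply ContinuousOn.log
  · fun_prop
  · intro t ht
    rw [Set.uIcc_of_le hk] at ht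
    rw [norm_ne_zero_iff, sub_ne_zero]
    rintro rfl
    exact hz ⟨t, ht, rfl⟩

lemma segPot_lower (k : ℝ) (hk : k ∈ Set.Ioo (0 : ℝ) 1) :
    ∃ C : ℝ, 0 ≤ C ∧ ∀ z : ℂ, z ∉ (fun x : ℝ => (x : ℂ)) '' Set.Icc k 1 →
      z.re ∈ Set.Icc (-1 : ℝ) 2 → 0 ≤ segPot k z + C := by
  obtain ⟨M, hM⟩ := (isCompact_Icc (a := (-2 : ℝ)) (b := 2)).exists_bound_of_continuousOn
    Real.continuous_mul_log.continuousOn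
  have hM0 : 0 ≤ M := (norm_nonneg _).trans (hM 0 (by norm_num))
  refine ⟨2 * M + 1, by positivity, ?_⟩
  intro z hz hre
  obtain ⟨hk0, hk1⟩ := hk
  have h1 : ∫ t in k..1, Real.log (z.re - t) ≤ segPot k z := by
    unfold segPot
    apply intervalIntegral.integral_mono_ae hk1.le
    · have := (intervalIntegral.intervalIntegrable_log' (a := z.re - k) (b := z.re - 1)).comp_sub_left z.re
      simpa using this
    · exact seg_intble k hk1.le z hz
    · have : ∀ᵐ t : ℝ, t ≠ z.re := by
        simp [ae_iff, measure_singleton]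
      filter_upwards [this] with t ht
      rw [← Real.log_abs]
      apply Real.log_le_log
      · exact abs_pos.2 (sub_ne_zero.2 ht.symm)
      · simpa using Complex.abs_re_le_norm (z - (t : ℂ))
  have h2 : ∫ t in k..1, Real.log (z.re - t) = ∫ s in (z.re - 1)..(z.re - k), Real.log s := by
    rw [intervalIntegral.integral_comp_sub_left (fun s => Real.log s)]
  rw [h2, integral_log] at h1
  have a1 := abs_le.1 (hM (z.re - 1) ⟨by linarith [hre.1], by linarith [hre.2]⟩)
  have a2 := abs_le.1 (hM (z.re - k) ⟨by linarith [hre.1], by linarith [hre.2]⟩)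
  linarith [a1.1, a1.2, a2.1, a2.2]

lemma segPot_large (k ρ : ℝ) (hk : k ∈ Set.Ioo (0 : ℝ) 1) (hρ : 1 < ρ) (z : ℂ)
    (hz : z ∉ (fun x : ℝ => (x : ℂ)) '' Set.Icc k 1) (hn : ‖z‖ = ρ) :
    (1 - k) * Real.log (ρ - 1) ≤ segPot k z := by
  have : ∫ t in k..1, Real.log (ρ - 1) = (1 - k) * Real.log (ρ - 1) := by simp
  rw [← this]
  unfold segPot
  apply intervalIntegral.integral_mono_on hk.2.le (by simp) (seg_intble k hk.2.le z hz)
  intro t ht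
  apply Real.log_le_log (by linarith)
  have h1 := norm_sub_norm_le z (t : ℂ)
  have h2 : ‖(t : ℂ)‖ ≤ 1 := by
    rw [Complex.norm_real, Real.norm_eq_abs, abs_of_nonneg (by linarith [hk.1, ht.1])]
    exact ht.2
  linarith

lemma slit_iff (k a : ℝ) (z : ℂ) (hz : ‖z‖ < a⁻¹)
    (hzK : z ∉ (fun x : ℝ => (x : ℂ)) '' Set.Icc k 1) : z ∈ slitDomain k a := by
  rintro ⟨x, hx | hx, rfl⟩
  · exact hzK ⟨x, hx, rfl⟩
  · have h1 : a⁻¹ ≤ x := hx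
    have : x ≤ ‖(x : ℂ)‖ := by
      rw [Complex.norm_real]
      exact le_abs_self x
    simp only at hz
    linarith

lemma key_bound (k : ℝ) (hk : k ∈ Set.Ioo (0 : ℝ) 1) (C : ℝ) (hC0 : 0 ≤ C)
    (hC : ∀ z : ℂ, z ∉ (fun x : ℝ => (x : ℂ)) '' Set.Icc k 1 →
      z.re ∈ Set.Icc (-1 : ℝ) 2 → 0 ≤ segPot k z + C)
    (a ρ : ℝ) (hρ : 2 < ρ) (hρa : ρ < a⁻¹) (u : ℂ → ℝ)
    (hharm : IsHarmonicOnSet u (slitDomain k a))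
    (hbdd : ∀ z : ℂ, 0 ≤ u z ∧ u z ≤ 1)
    (hbdry0 : ∀ x ∈ Set.Icc k 1,
      Tendsto u (nhdsWithin ((x : ℝ) : ℂ) (slitDomain k a)) (nhds 0)) :
    u 0 ≤ (segPot k 0 + C) * ((1 - k) * Real.log (ρ - 1))⁻¹ := by
  set K : Set ℂ := (fun x : ℝ => (x : ℂ)) '' Set.Icc k 1 with hK
  set m := (1 - k) * Real.log (ρ - 1) with hm
  have hk1 : k ≤ 1 := hk.2.le
  have hmpos : 0 < m := mul_pos (by linarith [hk.2]) (Real.log_pos (by linarith))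
  have hcl : IsClosed K := (isCompact_Icc.image Complex.continuous_ofReal).isClosed
  set h : ℂ → ℝ := fun z => u z - m⁻¹ • (segPot k z + C) with hh
  have hsl : ∀ z ∈ Metric.closedBall (0 : ℂ) ρ \ K, z ∈ slitDomain k a := by
    intro z hz
    apply slit_iff k a z _ hz.2
    have : ‖z‖ ≤ ρ := by simpa using hz.1
    linarith
  have hPc : ContinuousOn (segPot k) Kᶜ := by
    intro z hz
    obtain ⟨r, hr, hsub⟩ := dist_seg k z hz
    exact (segPot_contAt k r hk1 hr z hsub).continuousWithinAt
  have huc : ContinuousOn u (Metric.closedBall (0 : ℂ) ρ \ K) := hharm.1.mono hsl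
  have hgc : ContinuousOn (fun z => segPot k z + C) (Metric.closedBall (0 : ℂ) ρ \ K) :=
    (hPc.mono fun z hz => hz.2).add continuousOn_const
  have key := max_principle_aux K ρ h ?_ ?_ ?_ ?_ 0 ?_
  · simp only [hh, smul_eq_mul] at key
    linarith [mul_comm (segPot k 0 + C) m⁻¹]
  · exact huc.sub (hgc.const_smul m⁻¹)
  · intro z hz
    have hopen : IsOpen (Metric.ball (0 : ℂ) ρ \ K) := Metric.isOpen_ball.sdiff hcl
    obtain ⟨r', hr', hsub'⟩ := Metric.nhds_basis_closedBall.mem_iff.1 (hopen.mem_nhds hz)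
    set r := r' / 2 with hrdef
    have hr : 0 < r := by positivity
    have h2r : 2 * r = r' := by simp [hrdef]; ring
    have hsub2 : Metric.closedBall z (2 * r) ⊆ Metric.ball (0 : ℂ) ρ \ K := by rwa [h2r]
    have hsub1 : Metric.closedBall z r ⊆ Metric.ball (0 : ℂ) ρ \ K :=
      (Metric.closedBall_subset_closedBall (by linarith)).trans hsub2
    have hsubc : Metric.closedBall z r ⊆ Metric.closedBall (0 : ℂ) ρ \ K :=
      hsub1.trans (Set.diff_subset_diff_left Metric.ball_subset_closedBall)
    have hsphc := Metric.sphere_subset_closedBall.trans hsubc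
    refine ⟨r, hr, hsub1, ?_⟩
    have hum : u z = Real.circleAverage u z r := by
      rw [hharm.2 z (hsl z (hsubc (Metric.mem_closedBall_self hr.le))) r hr
        (fun w hw => hsl w (hsubc hw)), Real.circleAverage_def]
      simp [circleMap]
    have hPm := segPot_mean k r hk1 hr z (hsub2.trans fun w hw => hw.2)
    have hIu : CircleIntegrable u z r := ContinuousOn.circleIntegrable hr.le (huc.mono hsphc)
    have hIg : CircleIntegrable (fun z => segPot k z + C) z r :=
      ContinuousOn.circleIntegrable hr.le (hgc.mono hsphc)
    have hIP : CircleIntegrable (segPot k) z r :=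
      ContinuousOn.circleIntegrable hr.le (hPc.mono fun w hw => (hsphc hw).2)
    apply le_of_eq
    simp only [hh]
    rw [Real.circleAverage_fun_sub hIu hIg.const_fun_smul, Real.circleAverage_fun_smul,
      Real.circleAverage_fun_add hIP (by simp), Real.circleAverage_const, hPm, ← hum]
  · intro z hz hzK
    have h1 := segPot_large k ρ hk (by linarith) z hzK (by simpa using hz)
    have h2 := (hbdd z).2
    have h3 : 1 ≤ m⁻¹ * (segPot k z + C) := by
      rw [inv_mul_eq_div, le_div_iff₀ hmpos]
      linarith
    simp only [hh, smul_eq_mul]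
    linarith
  · rintro x ⟨t, ht, rfl⟩ δ hδ
    have hn : ‖(t : ℂ)‖ ≤ 1 := by
      rw [Complex.norm_real, Real.norm_eq_abs, abs_of_nonneg (by linarith [hk.1, ht.1])]
      exact ht.2
    have hmem : ∀ᶠ z in nhdsWithin (t : ℂ) Kᶜ, ‖z‖ < ρ :=
      nhdsWithin_le_nhds (continuous_norm.continuousAt.eventually_lt_const (by linarith))
    have hself : ∀ᶠ z in nhdsWithin (t : ℂ) Kᶜ, z ∈ Kᶜ := self_mem_nhdsWithin
    have hre : ∀ᶠ z in nhdsWithin (t : ℂ) Kᶜ, z.re ∈ Set.Icc (-1 : ℝ) 2 := by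
      apply nhdsWithin_le_nhds
      apply Complex.continuous_re.continuousAt.eventually_mem
      apply Icc_mem_nhds
      · simp only [Complex.ofReal_re]
        linarith [hk.1, ht.1]
      · simp only [Complex.ofReal_re]
        linarith [ht.2]
    have hle : nhdsWithin (t : ℂ) Kᶜ ≤ nhdsWithin (t : ℂ) (slitDomain k a) := by
      apply le_inf nhdsWithin_le_nhds
      rw [le_principal_iff]
      filter_upwards [hmem, hself] with z hz1 hz2
      exact slit_iff k a z (hz1.trans hρa) hz2
    have hu := ((hbdry0 t ht).mono_left hle).eventually_lt_const hδ
    filter_upwards [hu, hself, hre] with z h1 h2 h3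
    have := hC z h2 h3
    have : 0 ≤ m⁻¹ * (segPot k z + C) := by positivity
    simp only [hh, smul_eq_mul]
    linarith
  · refine ⟨by simp; linarith, ?_⟩
    rintro ⟨t, ht, h0⟩
    have : t = 0 := by simpa using h0
    linarith [hk.1, ht.1]

/-- Harmonic measure estimate: if for every `a ∈ (0,1)` the function `u a` is
the harmonic measure of `[1/a, ∞)` in `Ω_{k,a}` at the pole (bounded harmonic,
boundary values `1` on `[1/a,∞)` and `0` on `[k,1]`), then `u a 0 → 0` as
`a → 0⁺`; consequently the harmonic measure of `[k,1]` at `0` tends to `1`. -/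
theorem harmonic_measure_far_interval_tendsto_zero
    (k : ℝ) (hk : k ∈ Set.Ioo (0 : ℝ) 1)
    (u : ℝ → ℂ → ℝ)
    (hharm : ∀ a ∈ Set.Ioo (0 : ℝ) 1, IsHarmonicOnSet (u a) (slitDomain k a))
    (hbdd : ∀ a ∈ Set.Ioo (0 : ℝ) 1, ∀ z : ℂ, 0 ≤ u a z ∧ u a z ≤ 1)
    (hbdry1 : ∀ a ∈ Set.Ioo (0 : ℝ) 1, ∀ x : ℝ, a⁻¹ ≤ x →
      Tendsto (u a) (nhdsWithin (x : ℂ) (slitDomain k a)) (nhds 1))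
    (hbdry0 : ∀ a ∈ Set.Ioo (0 : ℝ) 1, ∀ x ∈ Set.Icc k 1,
      Tendsto (u a) (nhdsWithin ((x : ℝ) : ℂ) (slitDomain k a)) (nhds 0)) :
    Tendsto (fun a : ℝ => u a 0) (nhdsWithin 0 (Set.Ioi 0)) (nhds 0) ∧
    Tendsto (fun a : ℝ => 1 - u a 0) (nhdsWithin 0 (Set.Ioi 0)) (nhds 1) := by
  have main : Tendsto (fun a : ℝ => u a 0) (nhdsWithin 0 (Set.Ioi 0)) (nhds 0) := by
    obtain ⟨C, hC0, hC⟩ := segPot_lower k hk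
    have hinv : Tendsto (fun a : ℝ => a⁻¹ / 2 - 1) (nhdsWithin 0 (Set.Ioi 0)) atTop :=
      tendsto_atTop_add_const_right _ _ (tendsto_inv_nhdsGT_zero.atTop_div_const (by norm_num))
    have hlim : Tendsto (fun a : ℝ => (segPot k 0 + C) *
        ((1 - k) * Real.log (a⁻¹ / 2 - 1))⁻¹) (nhdsWithin 0 (Set.Ioi 0)) (nhds 0) := by
      have h1 := (Real.tendsto_log_atTop.comp hinv).const_mul_atTop
        (show (0 : ℝ) < 1 - k by linarith [hk.2])
      simpa using h1.inv_tendsto_atTop.const_mul (segPot k 0 + C)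
    have hsmall : ∀ᶠ a : ℝ in nhdsWithin 0 (Set.Ioi 0), a ∈ Set.Ioo (0 : ℝ) (1 / 4) :=
      Ioo_mem_nhdsGT (by norm_num)
    refine squeeze_zero' ?_ ?_ hlim
    · filter_upwards [hsmall] with a ha
      exact (hbdd a ⟨ha.1, by linarith [ha.2]⟩ 0).1
    · filter_upwards [hsmall] with a ha
      have ha' : a ∈ Set.Ioo (0 : ℝ) 1 := ⟨ha.1, by linarith [ha.2]⟩
      have h4 : 4 < a⁻¹ := by
        rw [lt_inv_comm₀ (by norm_num) ha.1]
        linarith [ha.2]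
      exact key_bound k hk C hC0 hC a (a⁻¹ / 2) (by linarith) (by linarith) (u a)
        (hharm a ha') (hbdd a ha') (hbdry0 a ha')
  refine ⟨main, ?_⟩
  simpa using main.const_sub 1
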